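/- There is an absolute constant c > 0 such that for every n ≥ 2, every edge-weighted tree T on n vertices admits a shortcutting with hop-diameter 2 and treewidth at most c·log n. -/

import Mathlib

open SimpleGraph

/-- The weight of a walk: the sum of the weights of its edges. -/
noncomputable def walkWeight {V : Type} {G : SimpleGraph V} (w : Sym2 V → ℝ) {u v : V}
    (p : G.Walk u v) : ℝ := (p.edges.map w).sum

/-- The unique path between two vertices of a tree (as a walk). -/
noncomputable def treePath {V : Type} {T : SimpleGraph V} (hT : T.IsTree) (u v : V) :
    T.Walk u v :=
  letI := Classical.decEq V
  ((hT.isConnected.preconnected u v).some.toPath : T.Path u v)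

/-- The shortest-path metric of an edge-weighted tree. -/
noncomputable def treeDist {V : Type} {T : SimpleGraph V} (hT : T.IsTree) (w : Sym2 V → ℝ)
    (u v : V) : ℝ := walkWeight w (treePath hT u v)

/-- `H` is a 1-spanner with hop-diameter `k` of the distance function `d`:
between every two vertices there is a path in `H` with at most `k` edges whose
total weight equals their distance. -/
def IsOneSpannerHop {V : Type} (H : SimpleGraph V) (d : V → V → ℝ) (k : ℕ) : Prop :=
  ∀ u v : V, ∃ (m : ℕ) (x : Fin (m+1) → V), m ≤ k ∧ x 0 = u ∧ x (Fin.last m) = v ∧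
    (∀ i : Fin m, H.Adj (x i.castSucc) (x i.succ)) ∧
    (∑ i : Fin m, d (x i.castSucc) (x i.succ)) = d u v

/-- `H` is a `t`-spanner with hop-diameter `k` of the distance function `d`. -/
def IsSpannerHop {V : Type} (H : SimpleGraph V) (d : V → V → ℝ) (k : ℕ) (t : ℝ) : Prop :=
  ∀ u v : V, ∃ (m : ℕ) (x : Fin (m+1) → V), m ≤ k ∧ x 0 = u ∧ x (Fin.last m) = v ∧
    (∀ i : Fin m, H.Adj (x i.castSucc) (x i.succ)) ∧
    (∑ i : Fin m, d (x i.castSucc) (x i.succ)) ≤ t * d u v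

/-- A tree decomposition of a graph `G` with index type `ι`. -/
structure TreeDecomp {V : Type} (G : SimpleGraph V) (ι : Type) where
  tree : SimpleGraph ι
  tree_isTree : tree.IsTree
  bag : ι → Finset V
  mem_bag : ∀ v : V, ∃ i, v ∈ bag i
  edge_bag : ∀ u v : V, G.Adj u v → ∃ i, u ∈ bag i ∧ v ∈ bag i
  bag_connected : ∀ v : V, (tree.induce {i : ι | v ∈ bag i}).Connected

/-- The treewidth of `G` is at most the real number `r`. -/
def TreewidthLE {V : Type} (G : SimpleGraph V) (r : ℝ) : Prop :=
  ∃ (ι : Type) (td : TreeDecomp G ι), ∀ i : ι, ((td.bag i).card : ℝ) - 1 ≤ r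

/-- The treewidth of `G` is at least the real number `r`. -/
def TreewidthGE {V : Type} (G : SimpleGraph V) (r : ℝ) : Prop :=
  ∀ (ι : Type) (td : TreeDecomp G ι), ∃ i : ι, r ≤ ((td.bag i).card : ℝ) - 1

/-- The arboricity of `G` is at most `m`: the edges of `G` can be covered by `m` forests. -/
def ArboricityLE {V : Type} (G : SimpleGraph V) (m : ℕ) : Prop :=
  ∃ F : Fin m → SimpleGraph V, (∀ i, F i ≤ G) ∧ (∀ i, (F i).IsAcyclic) ∧
    ∀ u v : V, G.Adj u v → ∃ i, (F i).Adj u v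

/-- The arboricity of `G` is at most the real number `r`. -/
def ArboricityLEReal {V : Type} (G : SimpleGraph V) (r : ℝ) : Prop :=
  ∃ m : ℕ, (m : ℝ) ≤ r ∧ ArboricityLE G m

/-- Ackermann-type function `A`. -/
def ackA : ℕ → ℕ → ℕ
  | 0, n => 2 * n
  | _ + 1, 0 => 1
  | k + 1, n + 1 => ackA k (ackA (k + 1) n)

/-- Ackermann-type function `B`. -/
def ackB : ℕ → ℕ → ℕ
  | 0, n => n ^ 2
  | _ + 1, 0 => 2
  | k + 1, n + 1 => ackB k (ackB (k + 1) n)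

/-- The inverse Ackermann function `α_j(n)`:
`α_{2k}(n) = min {s : A(k,s) ≥ n}` and `α_{2k+1}(n) = min {s : B(k,s) ≥ n}`. -/
noncomputable def invAck (j n : ℕ) : ℕ :=
  if j % 2 = 0 then sInf {s : ℕ | n ≤ ackA (j / 2) s} else sInf {s : ℕ | n ≤ ackB (j / 2) s}

/-- The uniform line metric on `{0, …, n-1}`. -/
def lineDist (n : ℕ) (i j : Fin n) : ℝ := |(i : ℝ) - (j : ℝ)|

/-- `x` is an ancestor of `y` in the tree `T` rooted at `r`:
`x` lies on the unique path from `r` to `y`. -/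
def IsAncestor {V : Type} {T : SimpleGraph V} (hT : T.IsTree) (r x y : V) : Prop :=
  x ∈ (treePath hT r y).support

/-- `G` contains `K_t` as a minor: there are `t` pairwise disjoint connected vertex
subsets with an edge between every two of them. -/
def HasCliqueMinor {V : Type} (G : SimpleGraph V) (t : ℕ) : Prop :=
  ∃ B : Fin t → Set V,
    (∀ i j, i ≠ j → Disjoint (B i) (B j)) ∧
    (∀ i, (G.induce (B i)).Connected) ∧
    (∀ i j, i ≠ j → ∃ u ∈ B i, ∃ v ∈ B j, G.Adj u v)

section TreePaths

variable {V : Type} {T : SimpleGraph V} (hT : T.IsTree)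

lemma treePath_isPath (u v : V) : (treePath hT u v).IsPath := by
  classical
  unfold treePath
  exact Subtype.property _

lemma treePath_eq {u v : V} {p : T.Walk u v} (hp : p.IsPath) : treePath hT u v = p :=
  (hT.existsUnique_path u v).unique (treePath_isPath hT u v) hp

/-- The set of vertices on the tree path between two vertices. -/
def treeSegment (u v : V) : Set V := {x | x ∈ (treePath hT u v).support}

lemma treeSegment_eq {u v : V} {p : T.Walk u v} (hp : p.IsPath) :
    treeSegment hT u v = {x | x ∈ p.support} := by
  rw [treeSegment, treePath_eq hT hp]

lemma left_mem_treeSegment (u v : V) : u ∈ treeSegment hT u v :=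
  (treePath hT u v).start_mem_support

lemma right_mem_treeSegment (u v : V) : v ∈ treeSegment hT u v :=
  (treePath hT u v).end_mem_support

lemma treeSegment_self (u : V) : treeSegment hT u u = {u} := by
  rw [treeSegment_eq hT (Walk.IsPath.nil (u := u))]
  ext; simp

lemma treeSegment_comm (u v : V) : treeSegment hT u v = treeSegment hT v u := by
  rw [treeSegment_eq hT (treePath_isPath hT v u).reverse]
  ext; simp [treeSegment]

lemma treeSegment_subset_left {u v y : V} (hy : y ∈ treeSegment hT u v) :
    treeSegment hT u y ⊆ treeSegment hT u v := by
  classical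
  rw [treeSegment_eq hT ((treePath_isPath hT u v).takeUntil hy)]
  exact fun x hx => Walk.support_takeUntil_subset_support _ hy hx

lemma treeSegment_subset_union (u v w : V) :
    treeSegment hT u w ⊆ treeSegment hT u v ∪ treeSegment hT v w := by
  classical
  rw [treeSegment_eq hT ((treePath hT u v).append (treePath hT v w)).bypass_isPath]
  intro x hx
  exact (Walk.mem_support_append_iff _ _).1 (Walk.support_bypass_subset_support _ hx)

lemma treeSegment_subset_treeSegment {u v x y : V} (hx : x ∈ treeSegment hT u v)
    (hy : y ∈ treeSegment hT u v) :
    treeSegment hT x y ⊆ treeSegment hT u v := by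
  refine (treeSegment_subset_union hT x u y).trans (Set.union_subset ?_ ?_)
  · rw [treeSegment_comm]; exact treeSegment_subset_left hT hx
  · exact treeSegment_subset_left hT hy

lemma mem_treeSegment_of_adj {c c' u : V} (h : T.Adj c c') (hc : c ∉ treeSegment hT c' u) :
    c' ∈ treeSegment hT c u := by
  have hp : (Walk.cons h (treePath hT c' u)).IsPath :=
    (Walk.cons_isPath_iff _ _).2 ⟨treePath_isPath hT c' u, hc⟩
  rw [treeSegment_eq hT hp]
  simp

lemma exists_adj_mem_treeSegment {c v : V} (hne : c ≠ v) :
    ∃ c' ∈ treeSegment hT c v, T.Adj c c' ∧ c ∉ treeSegment hT c' v := by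
  have hp := treePath_isPath hT c v
  cases h : treePath hT c v with
  | nil => exact absurd rfl hne
  | @cons _ c' _ hadj q =>
    rw [h, Walk.cons_isPath_iff] at hp
    refine ⟨c', ?_, hadj, ?_⟩
    · simp [treeSegment, h]
    · rw [treeSegment_eq hT hp.1]; exact hp.2

lemma treeDist_self (w : Sym2 V → ℝ) (u : V) : treeDist hT w u u = 0 := by
  rw [treeDist, treePath_eq hT (Walk.IsPath.nil (u := u))]
  simp [walkWeight]

lemma treeDist_add_of_mem_treeSegment (w : Sym2 V → ℝ) {u v z : V} (hz : z ∈ treeSegment hT u v) :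
    treeDist hT w u z + treeDist hT w z v = treeDist hT w u v := by
  classical
  have hp := treePath_isPath hT u v
  have hs := (treePath hT u v).take_spec hz
  rw [treeDist, treeDist, treeDist, treePath_eq hT (hp.takeUntil hz),
    treePath_eq hT (hp.dropUntil hz)]
  conv_rhs => rw [← hs]
  simp [walkWeight, Walk.edges_append]

end TreePaths

section Ranking

variable {V : Type} [Fintype V] {T : SimpleGraph V} (hT : T.IsTree)

open Classical in
lemma exists_centroid (C : Finset V) (hC : C.Nonempty)
    (hconv : ∀ u ∈ C, ∀ v ∈ C, treeSegment hT u v ⊆ C) :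
    ∃ c ∈ C, ∀ v ∈ C, v ≠ c → 2 * (C.filter fun u => c ∉ treeSegment hT u v).card ≤ C.card := by
  by_contra! hbad
  let B : V → V → Finset V := fun c v => C.filter fun u => c ∉ treeSegment hT u v
  let bad : Finset (V × V) :=
    (C ×ˢ C).filter fun p => p.2 ≠ p.1 ∧ C.card < 2 * (B p.1 p.2).card
  have hne : bad.Nonempty := by
    obtain ⟨c, hc⟩ := hC
    obtain ⟨v, hv, hvc, h⟩ := hbad c hc
    exact ⟨(c, v), by simp [bad, B, hc, hv, hvc, h]⟩
  obtain ⟨⟨c, v⟩, hcv, hmin⟩ := bad.exists_min_image (fun p => (B p.1 p.2).card) hne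
  simp only [bad, Finset.mem_filter, Finset.mem_product] at hcv
  obtain ⟨⟨hc, hv⟩, hvc, hlt⟩ := hcv
  obtain ⟨c', hc'seg, hadj, hcc'⟩ := exists_adj_mem_treeSegment hT hvc.symm
  have hc' : c' ∈ C := hconv c hc v hv hc'seg
  obtain ⟨v', hv', hvc', hlt'⟩ := hbad c' hc'
  obtain ⟨u, hu⟩ : (B c v ∩ B c' v').Nonempty := by
    rw [← Finset.card_pos]
    have h1 := Finset.card_union_add_card_inter (B c v) (B c' v')
    have h2 : (B c v ∪ B c' v').card ≤ C.card :=
      Finset.card_le_card (Finset.union_subset (Finset.filter_subset _ _)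
        (Finset.filter_subset _ _))
    have h3 : C.card < 2 * (B c' v').card := hlt'
    omega
  simp only [B, Finset.mem_inter, Finset.mem_filter] at hu
  obtain ⟨⟨-, hcu⟩, -, hc'u⟩ := hu
  have hcu' : c' ∈ treeSegment hT c u := by
    refine mem_treeSegment_of_adj hT hadj fun h => ?_
    rcases treeSegment_subset_union hT c' v u h with h | h
    · exact hcc' h
    · exact hcu (treeSegment_comm hT v u ▸ h)
  have hss : B c' v' ⊂ B c v := by
    refine (Finset.ssubset_iff_of_subset fun x hx => ?_).2 ⟨c', ?_, ?_⟩
    · simp only [B, Finset.mem_filter] at hx ⊢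
      refine ⟨hx.1, fun h => ?_⟩
      rcases treeSegment_subset_union hT x u v h with h | h
      · have h1 : c' ∈ treeSegment hT x u :=
          treeSegment_subset_treeSegment hT h (right_mem_treeSegment hT x u) hcu'
        rcases treeSegment_subset_union hT x v' u h1 with h | h
        · exact hx.2 h
        · exact hc'u (treeSegment_comm hT v' u ▸ h)
      · exact hcu h
    · simp [B, hc', hcc']
    · simp [B, left_mem_treeSegment]
  have := hmin (c', v') (by simp only [bad, Finset.mem_filter, Finset.mem_product]
                            exact ⟨⟨hc', hv'⟩, hvc', hlt'⟩)
  exact absurd (Finset.card_lt_card hss) (not_lt.2 this)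

open Classical in
/-- The vertices that the tree joins to `v` inside `S`. -/
noncomputable def treeComponent (S : Set V) (v : V) : Finset V :=
  Finset.univ.filter fun u => treeSegment hT u v ⊆ S

lemma mem_treeComponent {S : Set V} {u v : V} :
    u ∈ treeComponent hT S v ↔ treeSegment hT u v ⊆ S := by
  simp [treeComponent]

lemma treeComponent_eq {S : Set V} {u v : V} (h : treeSegment hT u v ⊆ S) :
    treeComponent hT S u = treeComponent hT S v := by
  ext x
  rw [mem_treeComponent, mem_treeComponent]
  constructor <;> intro hx
  · exact (treeSegment_subset_union hT x u v).trans (Set.union_subset hx h)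
  · exact (treeSegment_subset_union hT x v u).trans
      (Set.union_subset hx (treeSegment_comm hT u v ▸ h))

lemma treeSegment_subset_treeComponent {S : Set V} {u v x : V} (hu : u ∈ treeComponent hT S x)
    (hv : v ∈ treeComponent hT S x) : treeSegment hT u v ⊆ treeComponent hT S x := by
  rw [mem_treeComponent] at hu hv
  have huv : treeSegment hT u v ⊆ S := (treeSegment_subset_union hT u x v).trans
    (Set.union_subset hu (treeSegment_comm hT v x ▸ hv))
  intro y hy
  rw [Finset.mem_coe, mem_treeComponent]
  refine (treeSegment_subset_union hT y u x).trans (Set.union_subset ?_ hu)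
  exact (treeSegment_subset_treeSegment hT hy (left_mem_treeSegment hT u v)).trans huv

/-- A set whose components have fewer than `2 ^ k` vertices has a vertex ranking with `k`
levels: the path between two vertices of equal level passes through a lower level. -/
lemma exists_ranking (k : ℕ) (S : Set V) (hS : ∀ v ∈ S, (treeComponent hT S v).card < 2 ^ k) :
    ∃ l : V → ℕ, (∀ v ∈ S, l v < k) ∧
      ∀ u v, u ≠ v → l u = l v → treeSegment hT u v ⊆ S → ∃ y ∈ treeSegment hT u v, l y < l u := by
  classical
  induction k generalizing S with
  | zero =>
    have hemp : ∀ v, v ∉ S := fun v hv => by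
      have h1 := hS v hv
      have h2 : v ∈ treeComponent hT S v := by
        rw [mem_treeComponent, treeSegment_self]; simpa using hv
      have := Finset.card_pos.2 ⟨v, h2⟩
      omega
    exact ⟨fun _ => 0, fun v hv => absurd hv (hemp v),
      fun u v _ _ h => absurd (h (left_mem_treeSegment hT u v)) (hemp u)⟩
  | succ k ih =>
    have hcen : ∀ C : Finset V, ∃ c, C.Nonempty →
        (∀ u ∈ C, ∀ v ∈ C, treeSegment hT u v ⊆ C) → c ∈ C ∧
          ∀ v ∈ C, v ≠ c → 2 * (C.filter fun u => c ∉ treeSegment hT u v).card ≤ C.card := by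
      intro C
      by_cases h : C.Nonempty ∧ ∀ u ∈ C, ∀ v ∈ C, treeSegment hT u v ⊆ C
      · obtain ⟨c, hc, hc'⟩ := exists_centroid hT C h.1 h.2
        exact ⟨c, fun _ _ => ⟨hc, hc'⟩⟩
      · obtain ⟨v⟩ := hT.connected.nonempty
        exact ⟨v, fun h1 h2 => absurd ⟨h1, h2⟩ h⟩
    choose cen hcen using hcen
    let X : Set V := {v | cen (treeComponent hT S v) = v}
    have hmem : ∀ v ∈ S, v ∈ treeComponent hT S v := fun v hv => by
      rw [mem_treeComponent, treeSegment_self]; simpa using hv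
    obtain ⟨l, hl, hl'⟩ := ih (S \ X) (by
      rintro v ⟨hvS, hvX⟩
      set C := treeComponent hT S v with hC
      obtain ⟨hc, hcard⟩ := hcen C ⟨v, hmem v hvS⟩
        fun u hu w hw => treeSegment_subset_treeComponent hT hu hw
      have hcX : cen C ∈ X := by
        change cen (treeComponent hT S (cen C)) = cen C
        rw [treeComponent_eq hT ((mem_treeComponent hT).1 hc)]
      have hsub : treeComponent hT (S \ X) v ⊆ C.filter fun u => cen C ∉ treeSegment hT u v := by
        intro u hu
        rw [mem_treeComponent] at hu
        rw [Finset.mem_filter]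
        exact ⟨(mem_treeComponent hT).2 (hu.trans Set.sdiff_subset), fun h => (hu h).2 hcX⟩
      have h1 := Finset.card_le_card hsub
      have h2 := hcard v (hmem v hvS) fun h => hvX h.symm
      have h3 : C.card < 2 ^ (k + 1) := hS v hvS
      rw [pow_succ] at h3
      omega)
    refine ⟨fun v => if v ∈ X then 0 else l v + 1, fun v hv => ?_, fun u v huv hluv hseg => ?_⟩
    · by_cases hX : v ∈ X
      · simp [hX]
      · simpa [hX] using hl v ⟨hv, hX⟩
    · by_cases hu : u ∈ X <;> by_cases hv : v ∈ X <;> simp only [hu, hv, if_true, if_false] at hluv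
      · refine absurd ?_ huv
        rw [← show cen (treeComponent hT S u) = u from hu,
          ← show cen (treeComponent hT S v) = v from hv, treeComponent_eq hT hseg]
      · omega
      · omega
      · by_cases hX : ∃ y ∈ treeSegment hT u v, y ∈ X
        · obtain ⟨y, hy, hyX⟩ := hX
          exact ⟨y, hy, by simp [hyX, hu]⟩
        · push Not at hX
          obtain ⟨y, hy, hlt⟩ := hl' u v huv (by omega) fun y hy => ⟨hseg hy, hX y hy⟩
          exact ⟨y, hy, by simpa [hu, hX y hy] using hlt⟩

open Classical in
/-- The vertices `z` from which `v` is reached through levels higher than that of `z` only. -/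
noncomputable def rankAncestors (l : V → ℕ) (v : V) : Finset V :=
  Finset.univ.filter fun z => ∀ y ∈ treeSegment hT z v, y = z ∨ l z < l y

lemma mem_rankAncestors {l : V → ℕ} {z v : V} :
    z ∈ rankAncestors hT l v ↔ ∀ y ∈ treeSegment hT z v, y = z ∨ l z < l y := by
  simp [rankAncestors]

lemma self_mem_rankAncestors (l : V → ℕ) (v : V) : v ∈ rankAncestors hT l v := by
  rw [mem_rankAncestors, treeSegment_self]
  exact fun y hy => Or.inl hy

lemma card_rankAncestors_le {l : V → ℕ}
    (hl : ∀ u v, u ≠ v → l u = l v → ∃ y ∈ treeSegment hT u v, l y < l u)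
    {k : ℕ} (hk : ∀ v, l v < k) (v : V) :
    (rankAncestors hT l v).card ≤ k := by
  rw [← Finset.card_range k]
  refine Finset.card_le_card_of_injOn l (fun z _ => by simpa using hk z) fun z hz z' hz' h => ?_
  rw [Finset.mem_coe, mem_rankAncestors] at hz hz'
  by_contra hne
  obtain ⟨y, hy, hlt⟩ := hl z z' hne h
  rcases treeSegment_subset_union hT z v z' hy with hy | hy
  · rcases hz y hy with rfl | h' <;> omega
  · rw [treeSegment_comm] at hy
    rcases hz' y hy with rfl | h' <;> omega

lemma exists_common_rankAncestor {l : V → ℕ}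
    (hl : ∀ u v, u ≠ v → l u = l v → ∃ y ∈ treeSegment hT u v, l y < l u)
    (u v : V) :
    ∃ z ∈ treeSegment hT u v, z ∈ rankAncestors hT l u ∧ z ∈ rankAncestors hT l v := by
  classical
  obtain ⟨z, hz, hmin⟩ := Set.exists_min_image (treeSegment hT u v) l (Set.toFinite _)
    ⟨u, left_mem_treeSegment hT u v⟩
  have key : ∀ x ∈ treeSegment hT u v, z ∈ rankAncestors hT l x := by
    intro x hx
    rw [mem_rankAncestors]
    intro y hy
    have hy' := treeSegment_subset_treeSegment hT hz hx hy
    by_contra! hcon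
    have heq : l z = l y := le_antisymm (hmin y hy') hcon.2
    obtain ⟨y', hy'', hlt⟩ := hl z y (Ne.symm hcon.1) heq
    have := hmin y' (treeSegment_subset_treeSegment hT hz hy' hy'')
    omega
  exact ⟨z, hz, key u (left_mem_treeSegment hT u v), key v (right_mem_treeSegment hT u v)⟩

/-- The graph joining every vertex to its ancestors in a vertex ranking. -/
def rankGraph (l : V → ℕ) : SimpleGraph V :=
  SimpleGraph.fromRel fun u v => u ∈ rankAncestors hT l v

/-- The ancestor sets of a vertex ranking decompose its graph along the tree itself. -/
noncomputable def rankTreeDecomp (l : V → ℕ) : TreeDecomp (rankGraph hT l) V where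
  tree := T
  tree_isTree := hT
  bag := rankAncestors hT l
  mem_bag v := ⟨v, self_mem_rankAncestors hT l v⟩
  edge_bag u v h := by
    rcases h.2 with h | h
    · exact ⟨v, h, self_mem_rankAncestors hT l v⟩
    · exact ⟨u, self_mem_rankAncestors hT l u, h⟩
  bag_connected z := by
    rw [connected_iff_exists_forall_reachable]
    refine ⟨⟨z, self_mem_rankAncestors hT l z⟩, fun ⟨v, hv⟩ => ?_⟩
    have hsub : ∀ y ∈ (treePath hT z v).support, y ∈ {i | z ∈ rankAncestors hT l i} := by
      intro y hy
      rw [Set.mem_ofPred_eq, mem_rankAncestors] at hv ⊢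
      exact fun x hx => hv x (treeSegment_subset_left hT hy hx)
    exact ((treePath hT z v).induce _ hsub).reachable

lemma rankGraph_isOneSpannerHop {l : V → ℕ}
    (hl : ∀ u v, u ≠ v → l u = l v → ∃ y ∈ treeSegment hT u v, l y < l u)
    (w : Sym2 V → ℝ) :
    IsOneSpannerHop (rankGraph hT l) (treeDist hT w) 2 := by
  intro u v
  by_cases huv : u = v
  · subst huv
    exact ⟨0, ![u], by simp, rfl, rfl, fun i => i.elim0, by simp [treeDist_self]⟩
  obtain ⟨z, hz, hzu, hzv⟩ := exists_common_rankAncestor hT hl u v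
  by_cases h : (rankGraph hT l).Adj u v
  · exact ⟨1, ![u, v], by simp, rfl, rfl, by simpa using h, by simp⟩
  have hne : z ≠ u := fun e => h ⟨huv, Or.inl (e ▸ hzv)⟩
  have hne' : z ≠ v := fun e => h ⟨huv, Or.inr (e ▸ hzu)⟩
  refine ⟨2, ![u, z, v], le_rfl, rfl, rfl, ?_, ?_⟩
  · rw [Fin.forall_fin_two]
    exact ⟨⟨hne.symm, Or.inr hzu⟩, ⟨hne', Or.inl hzv⟩⟩
  · rw [Fin.sum_univ_two]
    exact treeDist_add_of_mem_treeSegment hT w hz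

end Ranking

/-- There is an absolute constant `c > 0` such that for every `n ≥ 2`,
every edge-weighted tree on `n` vertices admits a shortcutting with hop-diameter `2` and
treewidth at most `c·log n`. -/
theorem stmt1 :
    ∃ c : ℝ, 0 < c ∧
      ∀ n : ℕ, 2 ≤ n →
        ∀ (V : Type) (_ : Fintype V), Fintype.card V = n →
          ∀ (T : SimpleGraph V) (hT : T.IsTree) (w : Sym2 V → ℝ),
            (∀ e ∈ T.edgeSet, 0 < w e) →
            ∃ G' : SimpleGraph V,
              IsOneSpannerHop G' (treeDist hT w) 2 ∧
              TreewidthLE G' (c * Real.logb 2 n) := by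
  refine ⟨1, one_pos, fun n hn V _ hV T hT w _ => ?_⟩
  obtain ⟨l, hk, hl⟩ := exists_ranking hT (Nat.log 2 n + 1) Set.univ fun v _ =>
    ((Finset.card_le_univ _).trans_eq hV).trans_lt (Nat.lt_pow_succ_log_self one_lt_two n)
  replace hl : ∀ u v, u ≠ v → l u = l v → ∃ y ∈ treeSegment hT u v, l y < l u :=
    fun u v h h' => hl u v h h' (Set.subset_univ _)
  refine ⟨rankGraph hT l, rankGraph_isOneSpannerHop hT hl w, V, rankTreeDecomp hT l, fun i => ?_⟩
  have hcard : (((rankTreeDecomp hT l).bag i).card : ℝ) ≤ Nat.log 2 n + 1 := by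
    exact_mod_cast card_rankAncestors_le hT hl (fun v => hk v trivial) i
  have hlog : (Nat.log 2 n : ℝ) ≤ Real.logb 2 n := by
    simpa using Real.natLog_le_logb n 2
  linarith
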